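/- Let q be a nonzero real number. Then for every integer n ≥ 1: G_q(n + 2p_n) = (1/(2q))·G_q(n) + (n/(4p_n))·(2q − 1). -/

import Mathlib

noncomputable section

open MeasureTheory Filter Finset

/-- Distance from `x` to the nearest integer. -/
def distInt (x : ℝ) : ℝ := |x - round x|

/-- The Takagi–Landsberg function with parameter `a`:
`𝒯_a(x) = ∑_{n≥0} a^n · dist(2^n x, ℤ)`. -/
def takagi (a : ℝ) (x : ℝ) : ℝ := ∑' n : ℕ, a ^ n * distInt (2 ^ n * x)

/-- Weighted sum-of-binary-digits function: for `j = ∑ ω_i 2^i`,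
`s_q(j) = ∑ ω_i q^{i+1}`. -/
def sqN (q : ℝ) (j : ℕ) : ℝ := ∑ i ∈ Finset.range j, if j.testBit i then q ^ (i + 1) else 0

/-- `S_q(n) = ∑_{j<n} s_q(j)`. -/
def Sq (q : ℝ) (n : ℕ) : ℝ := ∑ j ∈ Finset.range n, sqN q j

/-- `G_q(n) = (1/(p_n q^{k_n})) (S_q(n) - (n/p_n) S_q(p_n))` where `k_n = ⌊log₂ n⌋`,
`p_n = 2^{k_n}`. -/
def Gq (q : ℝ) (n : ℕ) : ℝ :=
  (1 / ((2 ^ Nat.log 2 n : ℝ) * q ^ Nat.log 2 n)) *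
    (Sq q n - ((n : ℝ) / (2 ^ Nat.log 2 n : ℝ)) * Sq q (2 ^ Nat.log 2 n))

/-- Any range of positions that covers the binary digits of `j` computes `sqN q j`. -/
theorem sqN_eq_sum_range (q : ℝ) {j m : ℕ} (hj : j < 2 ^ m) :
    sqN q j = ∑ i ∈ Finset.range m, if j.testBit i then q ^ (i + 1) else 0 := by
  rw [sqN]
  rcases le_total j m with h | h
  · refine Finset.sum_subset (Finset.range_subset_range.2 h) fun i _ hi => ?_
    have hji : j ≤ i := by simpa using hi
    simp [Nat.testBit_lt_two_pow (hji.trans_lt Nat.lt_two_pow_self)]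
  · refine (Finset.sum_subset (Finset.range_subset_range.2 h) fun i _ hi => ?_).symm
    have hmi : m ≤ i := by simpa using hi
    simp [Nat.testBit_lt_two_pow (hj.trans_le (Nat.pow_le_pow_right two_pos hmi))]

theorem sqN_two_pow_add (q : ℝ) {j m : ℕ} (hj : j < 2 ^ m) :
    sqN q (2 ^ m + j) = sqN q j + q ^ (m + 1) := by
  have h : 2 ^ m + j < 2 ^ (m + 1) := by rw [pow_succ]; lia
  rw [sqN_eq_sum_range q h, sqN_eq_sum_range q hj, Finset.sum_range_succ,
    Nat.testBit_two_pow_add_eq, Nat.testBit_lt_two_pow hj]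
  congr 1
  refine Finset.sum_congr rfl fun i hi => ?_
  rw [Nat.testBit_two_pow_add_gt (Finset.mem_range.1 hi)]

theorem Sq_two_pow_add (q : ℝ) {n m : ℕ} (hn : n ≤ 2 ^ m) :
    Sq q (2 ^ m + n) = Sq q (2 ^ m) + (Sq q n + n * q ^ (m + 1)) := by
  have h : ∑ j ∈ Finset.range n, sqN q (2 ^ m + j) =
      ∑ j ∈ Finset.range n, (sqN q j + q ^ (m + 1)) :=
    Finset.sum_congr rfl fun j hj => sqN_two_pow_add q ((Finset.mem_range.1 hj).trans_le hn)
  rw [Sq, Finset.sum_range_add, h, Finset.sum_add_distrib]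
  simp [Sq]

theorem Gq_add_two_pow (q : ℝ) (hq : q ≠ 0) (n : ℕ) (hn : 1 ≤ n)
    (p : ℕ) (hp : p = 2 ^ Nat.log 2 n) :
    Gq q (n + 2 * p) = (1 / (2 * q)) * Gq q n + ((n : ℝ) / (4 * (p : ℝ))) * (2 * q - 1) := by
  subst hp
  have hlt : n < 2 ^ (Nat.log 2 n + 1) := Nat.lt_pow_succ_log_self one_lt_two n
  have hlog : Nat.log 2 (2 ^ (Nat.log 2 n + 1) + n) = Nat.log 2 n + 1 :=
    Nat.log_eq_of_pow_le_of_lt_pow (Nat.le_add_right _ _) (by rw [pow_succ _ (_ + 1)]; lia)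
  rw [show n + 2 * 2 ^ Nat.log 2 n = 2 ^ (Nat.log 2 n + 1) + n by ring]
  simp only [Gq, hlog]
  rw [Sq_two_pow_add q hlt.le]
  generalize Nat.log 2 n = k
  have hdouble := Sq_two_pow_add q (le_refl (2 ^ k))
  rw [← two_mul, ← pow_succ'] at hdouble
  rw [hdouble]
  push_cast
  field_simp
  ring

end
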